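/- arXiv:1701.08215 — 4 statements merged into one kernel-verified Lean document; each statement's English description precedes it below -/
import Mathlib

section
/- Let d ≥ 1 be an integer and C0 > 0. Let g : Q_1 → [0,∞) and s : Q_1 → ℝ be bounded measurable functions, and suppose that for every point z0 ∈ Q_1 and every r ∈ (0,1] with Q_r(z0) ⊆ Q_1 one has ess sup_{Q_{r/2}(z0)} g ≤ C0 ( r^{−d/2} ‖g‖_{L^∞_{t,x}L²_v(Q_r(z0))} + r² ‖s‖_{L^∞(Q_r(z0))} ). Then ess sup_{Q_{1/2}} g ≤ C ( ‖g‖_{L^∞_{t,x}L¹_v(Q_1)} + ‖s‖_{L^∞(Q_1)} ), where C depends only on d and C0. -/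
open MeasureTheory Real Set
open scoped RealInnerProductSpace

noncomputable section

abbrev V (d : ℕ) : Type := EuclideanSpace ℝ (Fin d)

/-- The Landau diffusion matrix entries `ā(v) i j` of a density `g`. -/
noncomputable def aBar (d : ℕ) (γ aC : ℝ) (g : V d → ℝ) (v : V d) (i j : Fin d) : ℝ :=
  aC * ∫ w : V d, ((if i = j then (1:ℝ) else 0) - w i * w j / ‖w‖ ^ 2) * ‖w‖ ^ (γ + 2) * g (v - w)

/-- The Landau coefficient `c̄(v)` of a density `g`. -/
noncomputable def cBar (d : ℕ) (γ cC : ℝ) (g : V d → ℝ) (v : V d) : ℝ :=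
  cC * ∫ w : V d, ‖w‖ ^ γ * g (v - w)

/-- Second partial derivative `∂_{v_i v_j} φ`. -/
noncomputable def pd2 {d : ℕ} (φ : V d → ℝ) (v : V d) (i j : Fin d) : ℝ :=
  fderiv ℝ (fun u => fderiv ℝ φ u (EuclideanSpace.single j 1)) v (EuclideanSpace.single i 1)

/-- The kinetic cylinder `Q_r(z0)`. -/
def kCyl (d : ℕ) (z0 : ℝ × V d × V d) (r : ℝ) : Set (ℝ × V d × V d) :=
  {z | z0.1 - r ^ 2 < z.1 ∧ z.1 ≤ z0.1 ∧
    ‖z.2.1 - z0.2.1 - (z.1 - z0.1) • z0.2.2‖ < r ^ 3 ∧ ‖z.2.2 - z0.2.2‖ < r}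

/-- The norm `‖g‖_{L^∞_{t,x} L¹_v (Q)}`. -/
noncomputable def normLinfL1 (d : ℕ) (g : ℝ × V d × V d → ℝ) (Q : Set (ℝ × V d × V d)) : ℝ :=
  essSup (fun q : ℝ × V d => ∫ v in {v : V d | (q.1, q.2, v) ∈ Q}, |g (q.1, q.2, v)|) volume

/-- The norm `‖g‖_{L^∞_{t,x} L²_v (Q)}`. -/
noncomputable def normLinfL2 (d : ℕ) (g : ℝ × V d × V d → ℝ) (Q : Set (ℝ × V d × V d)) : ℝ :=
  essSup (fun q : ℝ × V d =>
    Real.sqrt (∫ v in {v : V d | (q.1, q.2, v) ∈ Q}, |g (q.1, q.2, v)| ^ 2)) volume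

/-- The norm `‖s‖_{L^∞(Q)}` (essential supremum of `|s|` over `Q`). -/
noncomputable def normLinf (d : ℕ) (s : ℝ × V d × V d → ℝ) (Q : Set (ℝ × V d × V d)) : ℝ :=
  essSup (fun z => |s z|) (volume.restrict Q)

section EssSup

variable {α : Type*} [MeasurableSpace α] {μ : Measure α} {f : α → ℝ} {B c : ℝ}

/-- A nonnegative real function has nonnegative essential supremum, also for the zero measure. -/
lemma essSup_nonneg_of_nonneg (hf : ∀ x, 0 ≤ f x) : 0 ≤ essSup f μ := by
  rw [essSup_eq_sInf]
  by_cases hμ : μ = 0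
  · simp [hμ]
  · refine Real.sInf_nonneg fun a ha => ?_
    by_contra! h
    refine hμ (Measure.measure_univ_eq_zero.1 (measure_mono_null (fun x _ => ?_) ha))
    exact h.trans_le (hf x)

/-- A nonnegative bound valid almost everywhere bounds the essential supremum of a nonnegative
function, also for the zero measure. -/
lemma essSup_le_of_nonneg_of_ae_le (hf : ∀ x, 0 ≤ f x) (hc : 0 ≤ c) (h : ∀ᵐ x ∂μ, f x ≤ c) :
    essSup f μ ≤ c := by
  rw [essSup_eq_sInf]
  by_cases hμ : μ = 0
  · simpa [hμ] using hc
  · refine csInf_le ⟨0, fun a ha => ?_⟩ ?_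
    · by_contra! h'
      refine hμ (Measure.measure_univ_eq_zero.1 (measure_mono_null (fun x _ => ?_) ha))
      exact h'.trans_le (hf x)
    · simpa [ae_iff] using h

lemma ae_le_essSup_of_le (hB : ∀ x, f x ≤ B) : ∀ᵐ x ∂μ, f x ≤ essSup f μ :=
  ae_le_essSup (Filter.isBoundedUnder_of ⟨B, hB⟩)

end EssSup

lemma measurableSet_kCyl (d : ℕ) (z0 : ℝ × V d × V d) (r : ℝ) :
    MeasurableSet (kCyl d z0 r) := by
  refine MeasurableSet.inter (s₁ := {z : ℝ × V d × V d | z0.1 - r ^ 2 < z.1}) ?_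
    (MeasurableSet.inter (s₁ := {z : ℝ × V d × V d | z.1 ≤ z0.1}) ?_
      (MeasurableSet.inter
        (s₁ := {z : ℝ × V d × V d | ‖z.2.1 - z0.2.1 - (z.1 - z0.1) • z0.2.2‖ < r ^ 3})
        (s₂ := {z : ℝ × V d × V d | ‖z.2.2 - z0.2.2‖ < r}) ?_ ?_))
  · exact measurableSet_lt (by fun_prop) (by fun_prop)
  · exact measurableSet_le (by fun_prop) (by fun_prop)
  · exact measurableSet_lt (by fun_prop) (by fun_prop)
  · exact measurableSet_lt (by fun_prop) (by fun_prop)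

lemma kCyl_zero_mono (d : ℕ) {ρ ρ' : ℝ} (hρ : 0 ≤ ρ) (h : ρ ≤ ρ') :
    kCyl d 0 ρ ⊆ kCyl d 0 ρ' := by
  rintro ⟨t, x, v⟩ ⟨h1, h2, h3, h4⟩
  simp only [Prod.fst_zero, Prod.snd_zero, smul_zero, sub_zero] at h1 h2 h3 h4
  refine ⟨?_, ?_, ?_, ?_⟩ <;>
    simp only [Prod.fst_zero, Prod.snd_zero, smul_zero, sub_zero]
  · nlinarith
  · exact h2
  · exact h3.trans_le (by gcongr)
  · exact h4.trans_le h

lemma kCyl_subset_kCyl_add (d : ℕ) {ρ r : ℝ} (hρ : 0 ≤ ρ) (hr : 0 ≤ r) {z0 : ℝ × V d × V d}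
    (hz0 : z0 ∈ kCyl d 0 ρ) : kCyl d z0 r ⊆ kCyl d 0 (ρ + r) := by
  obtain ⟨t0, x0, v0⟩ := z0
  rintro ⟨t, x, v⟩ ⟨h1, h2, h3, h4⟩
  obtain ⟨k1, k2, k3, k4⟩ := hz0
  simp only [Prod.fst_zero, Prod.snd_zero, smul_zero, sub_zero] at h1 h2 h3 h4 k1 k2 k3 k4
  refine ⟨?_, ?_, ?_, ?_⟩ <;>
    simp only [Prod.fst_zero, Prod.snd_zero, smul_zero, sub_zero]
  · nlinarith [mul_nonneg hρ hr]
  · exact h2.trans k2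
  · have hx : x = (x - x0 - (t - t0) • v0) + x0 + (t - t0) • v0 := by abel
    have hs : ‖(t - t0) • v0‖ ≤ r ^ 2 * ρ := by
      rw [norm_smul, Real.norm_eq_abs]
      have : |t - t0| ≤ r ^ 2 := abs_le.2 ⟨by linarith, by nlinarith⟩
      gcongr
    have : ‖x‖ ≤ ‖x - x0 - (t - t0) • v0‖ + ‖x0‖ + ‖(t - t0) • v0‖ := by
      conv_lhs => rw [hx]
      exact norm_add₃_le
    have p1 : 0 ≤ ρ ^ 2 * r := by positivity
    have p2 : 0 ≤ ρ * r ^ 2 := by positivity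
    nlinarith
  · have := norm_add_le (v - v0) v0
    rw [sub_add_cancel] at this
    linarith

/-- A.e. bounds on small cylinders centred in `Q_ρ` give an a.e. bound on `Q_ρ`. -/
lemma ae_le_of_forall_kCyl (d : ℕ) {g : ℝ × V d × V d → ℝ} {ρ r K : ℝ} (hr : 0 < r)
    (h : ∀ z0 ∈ kCyl d 0 ρ, ∀ᵐ z ∂volume.restrict (kCyl d z0 r), g z ≤ K) :
    ∀ᵐ z ∂volume.restrict (kCyl d 0 ρ), g z ≤ K := by
  rw [ae_restrict_iff' (measurableSet_kCyl d 0 ρ)]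
  have htop : ∀ᵐ z : ℝ × V d × V d, z.1 ≠ 0 := by
    have : ∀ᵐ t : ℝ, t ≠ 0 := by simp [ae_iff]
    exact Measure.quasiMeasurePreserving_fst.ae this
  have hneg : volume {z : ℝ × V d × V d | (z ∈ kCyl d 0 ρ ∧ z.1 < 0) ∧ K < g z} = 0 := by
    refine measure_null_of_locally_null _ ?_
    rintro ⟨t, x, v⟩ ⟨⟨⟨h1, h2, h3, h4⟩, hlt⟩, -⟩
    simp only [Prod.fst_zero, Prod.snd_zero, smul_zero, sub_zero] at h1 h2 h3 h4 hlt
    obtain ⟨ε, hε, hεt, hεr, hεv⟩ : ∃ ε : ℝ, 0 < ε ∧ ε ≤ -t ∧ ε < r ^ 2 ∧ ε * ‖v‖ < r ^ 3 := by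
      have e1 : ∀ᶠ ε : ℝ in nhdsWithin 0 (Ioi 0), 0 < ε := self_mem_nhdsWithin
      have e2 : ∀ᶠ ε : ℝ in nhdsWithin 0 (Ioi 0), ε ≤ -t :=
        nhdsWithin_le_nhds (Iic_mem_nhds (by linarith))
      have e3 : ∀ᶠ ε : ℝ in nhdsWithin 0 (Ioi 0), ε < r ^ 2 :=
        nhdsWithin_le_nhds (Iio_mem_nhds (by positivity))
      have e4 : ∀ᶠ ε : ℝ in nhdsWithin 0 (Ioi 0), ε * ‖v‖ < r ^ 3 := by
        refine nhdsWithin_le_nhds (ContinuousAt.eventually_lt (by fun_prop) (by fun_prop) ?_)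
        rw [zero_mul]; positivity
      exact (e1.and (e2.and (e3.and e4))).exists
    have hz0 : ((t + ε, x, v) : ℝ × V d × V d) ∈ kCyl d 0 ρ := by
      refine ⟨?_, ?_, ?_, ?_⟩ <;>
        simp only [Prod.fst_zero, Prod.snd_zero, smul_zero, sub_zero]
      · linarith
      · linarith
      · exact h3
      · exact h4
    have hnear : ∀ᶠ z : ℝ × V d × V d in nhds (t, x, v), z ∈ kCyl d (t + ε, x, v) r := by
      have f1 : ∀ᶠ z : ℝ × V d × V d in nhds (t, x, v), t + ε - r ^ 2 < z.1 :=
        ContinuousAt.eventually_lt (by fun_prop) (by fun_prop) (by simp; linarith)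
      have f2 : ∀ᶠ z : ℝ × V d × V d in nhds (t, x, v), z.1 < t + ε :=
        ContinuousAt.eventually_lt (by fun_prop) (by fun_prop) (by simpa using hε)
      have f3 : ∀ᶠ z : ℝ × V d × V d in nhds (t, x, v),
          ‖z.2.1 - x - (z.1 - (t + ε)) • v‖ < r ^ 3 :=
        ContinuousAt.eventually_lt (by fun_prop) (by fun_prop)
          (by simpa [norm_smul, abs_of_pos hε] using hεv)
      have f4 : ∀ᶠ z : ℝ × V d × V d in nhds (t, x, v), ‖z.2.2 - v‖ < r :=
        ContinuousAt.eventually_lt (by fun_prop) (by fun_prop) (by simpa using hr)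
      filter_upwards [f1, f2, f3, f4] with z g1 g2 g3 g4
      exact ⟨g1, g2.le, g3, g4⟩
    refine ⟨kCyl d (t + ε, x, v) r ∩
      {z | (z ∈ kCyl d 0 ρ ∧ z.1 < 0) ∧ K < g z}, ?_, ?_⟩
    · exact Filter.inter_mem (nhdsWithin_le_nhds hnear) self_mem_nhdsWithin
    · have := h _ hz0
      rw [ae_restrict_iff' (measurableSet_kCyl _ _ _), ae_iff] at this
      refine measure_mono_null ?_ this
      rintro z ⟨hz, -, hK⟩
      simpa using ⟨hz, hK⟩
  have hneg' : ∀ᵐ z : ℝ × V d × V d, ¬ ((z ∈ kCyl d 0 ρ ∧ z.1 < 0) ∧ K < g z) := by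
    simpa only [ae_iff, not_not] using hneg
  filter_upwards [htop, hneg'] with z hz1 hz2 hz
  by_contra! hK
  exact hz2 ⟨⟨hz, lt_of_le_of_ne hz.2.1 hz1⟩, hK⟩

lemma measurableSet_slice_kCyl (d : ℕ) (z0 : ℝ × V d × V d) (r : ℝ) (t : ℝ) (x : V d) :
    MeasurableSet {v : V d | (t, x, v) ∈ kCyl d z0 r} :=
  (measurableSet_kCyl d z0 r).preimage (by fun_prop)

lemma slice_kCyl_subset_ball (d : ℕ) (z0 : ℝ × V d × V d) (r : ℝ) (t : ℝ) (x : V d) :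
    {v : V d | (t, x, v) ∈ kCyl d z0 r} ⊆ Metric.ball z0.2.2 r := fun v hv => by
  simpa [dist_eq_norm] using hv.2.2.2

lemma integrableOn_slice_kCyl (d : ℕ) {f : ℝ × V d × V d → ℝ} (hf : Measurable f) {B : ℝ}
    (hB : ∀ z, |f z| ≤ B) (z0 : ℝ × V d × V d) (r : ℝ) (t : ℝ) (x : V d) :
    IntegrableOn (fun v => f (t, x, v)) {v : V d | (t, x, v) ∈ kCyl d z0 r} := by
  refine Measure.integrableOn_of_bounded (M := B) ?_
    (hf.comp (by fun_prop)).aestronglyMeasurable (Filter.Eventually.of_forall fun v => hB _)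
  exact ((measure_mono (slice_kCyl_subset_ball d z0 r t x)).trans_lt measure_ball_lt_top).ne

/-- The mass of `g` on velocity slices of `Q_r(z0)` is a.e. at most its `L^∞L^1` norm. -/
lemma ae_integral_slice_le_normLinfL1 (d : ℕ) {g : ℝ × V d × V d → ℝ} (hg : Measurable g)
    {B : ℝ} (hB : ∀ z, |g z| ≤ B) (z0 : ℝ × V d × V d) (r : ℝ) :
    ∀ᵐ q : ℝ × V d, ∫ v in {v : V d | (q.1, q.2, v) ∈ kCyl d z0 r}, |g (q.1, q.2, v)|
      ≤ normLinfL1 d g (kCyl d z0 r) := by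
  have hB0 : 0 ≤ B := (abs_nonneg _).trans (hB 0)
  refine ae_le_essSup_of_le (B := ∫ _v in Metric.ball z0.2.2 r, B) fun q => ?_
  refine (integral_mono (integrableOn_slice_kCyl d hg.abs (by simpa using hB) z0 r q.1 q.2)
    ?_ fun v => hB _).trans ?_
  · exact (integrableOn_const (measure_ball_lt_top).ne).mono_set
      (slice_kCyl_subset_ball d z0 r q.1 q.2)
  · exact setIntegral_mono_set (integrableOn_const (measure_ball_lt_top).ne)
      (Filter.Eventually.of_forall fun _ => hB0)
      (slice_kCyl_subset_ball d z0 r q.1 q.2).eventuallyLE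

/-- Interpolation of `L^∞L^2` between `L^∞` and `L^∞L^1` on nested cylinders. -/
lemma normLinfL2_le_sqrt_mul (d : ℕ) {g : ℝ × V d × V d → ℝ} (hg : Measurable g)
    (hg0 : ∀ z, 0 ≤ g z) {B : ℝ} (hB : ∀ z, |g z| ≤ B) {z0 z1 : ℝ × V d × V d} {r r1 : ℝ}
    (hsub : kCyl d z0 r ⊆ kCyl d z1 r1) {K : ℝ} (hK0 : 0 ≤ K)
    (hK : ∀ᵐ z ∂volume.restrict (kCyl d z0 r), g z ≤ K) :
    normLinfL2 d g (kCyl d z0 r) ≤ √(K * normLinfL1 d g (kCyl d z1 r1)) := by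
  refine essSup_le_of_nonneg_of_ae_le (fun q => Real.sqrt_nonneg _) (Real.sqrt_nonneg _) ?_
  rw [ae_restrict_iff' (measurableSet_kCyl _ _ _)] at hK
  have hassoc : ∀ᵐ p : (ℝ × V d) × V d, (p.1.1, p.1.2, p.2) ∈ kCyl d z0 r →
      g (p.1.1, p.1.2, p.2) ≤ K :=
    (measurePreserving_prodAssoc (volume : Measure ℝ) (volume : Measure (V d))
      (volume : Measure (V d))).quasiMeasurePreserving.ae hK
  filter_upwards [Measure.ae_ae_of_ae_prod hassoc,
    ae_integral_slice_le_normLinfL1 d hg hB z1 r1] with q hq1 hq2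
  refine Real.sqrt_le_sqrt ?_
  have hint := integrableOn_slice_kCyl d hg.abs (by simpa using hB) z1 r1 q.1 q.2
  have hss : {v : V d | (q.1, q.2, v) ∈ kCyl d z0 r} ⊆ {v : V d | (q.1, q.2, v) ∈ kCyl d z1 r1} :=
    fun v hv => hsub hv
  calc ∫ v in {v : V d | (q.1, q.2, v) ∈ kCyl d z0 r}, |g (q.1, q.2, v)| ^ 2
      ≤ ∫ v in {v : V d | (q.1, q.2, v) ∈ kCyl d z0 r}, K * |g (q.1, q.2, v)| := by
        refine integral_mono_of_nonneg (Filter.Eventually.of_forall fun v => by positivity)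
          ((hint.mono_set hss).const_mul K) ?_
        refine (ae_restrict_iff' (measurableSet_slice_kCyl d z0 r q.1 q.2)).2 ?_
        filter_upwards [hq1] with v hv hmem
        have := hv hmem
        simp only [abs_of_nonneg (hg0 _)]
        nlinarith [hg0 (q.1, q.2, v)]
    _ = K * ∫ v in {v : V d | (q.1, q.2, v) ∈ kCyl d z0 r}, |g (q.1, q.2, v)| :=
        integral_const_mul _ _
    _ ≤ K * ∫ v in {v : V d | (q.1, q.2, v) ∈ kCyl d z1 r1}, |g (q.1, q.2, v)| := by
        refine mul_le_mul_of_nonneg_left (setIntegral_mono_set hint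
          (Filter.Eventually.of_forall fun v => abs_nonneg _) hss.eventuallyLE) hK0
    _ ≤ _ := mul_le_mul_of_nonneg_left hq2 hK0

/-- The local estimate on cylinders of radius `r` improves to an `L^∞`-`L^1` estimate with a
small multiple `ε` of the supremum on the larger cylinder. -/
lemma essSup_kCyl_le_of_local_estimate (d : ℕ) {C0 : ℝ} (hC0 : 0 < C0)
    {g s : ℝ × V d × V d → ℝ} (hg : Measurable g) (hg0 : ∀ z, 0 ≤ g z) {B : ℝ}
    (hBg : ∀ z, |g z| ≤ B) (hBs : ∀ z, |s z| ≤ B)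
    (hloc : ∀ z0 ∈ kCyl d 0 1, ∀ r ∈ Set.Ioc (0:ℝ) 1, kCyl d z0 r ⊆ kCyl d 0 1 →
        essSup g (volume.restrict (kCyl d z0 (r/2)))
          ≤ C0 * (r ^ (-(d:ℝ)/2) * normLinfL2 d g (kCyl d z0 r)
              + r ^ 2 * normLinf d s (kCyl d z0 r)))
    {ρ r ε : ℝ} (hρ : 0 ≤ ρ) (hr : 0 < r) (hρr : ρ + r ≤ 1) (hε : 0 < ε) :
    essSup g (volume.restrict (kCyl d 0 ρ)) ≤
      ε * essSup g (volume.restrict (kCyl d 0 (ρ + r)))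
        + (C0 ^ 2 * (r⁻¹) ^ d / (4 * ε) * normLinfL1 d g (kCyl d 0 1)
          + C0 * normLinf d s (kCyl d 0 1)) := by
  set M := essSup g (volume.restrict (kCyl d 0 (ρ + r)))
  set A := normLinfL1 d g (kCyl d 0 1)
  set S := normLinf d s (kCyl d 0 1)
  have hM0 : 0 ≤ M := essSup_nonneg_of_nonneg hg0
  have hA0 : 0 ≤ A := essSup_nonneg_of_nonneg fun q => integral_nonneg fun v => abs_nonneg _
  have hS0 : 0 ≤ S := essSup_nonneg_of_nonneg fun z => abs_nonneg _
  have hle : ∀ z, g z ≤ B := fun z => (le_abs_self _).trans (hBg z)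
  refine essSup_le_of_nonneg_of_ae_le hg0 (by positivity) ?_
  refine ae_le_of_forall_kCyl d (half_pos hr) fun z0 hz0 => ?_
  have hsub : kCyl d z0 r ⊆ kCyl d 0 (ρ + r) := kCyl_subset_kCyl_add d hρ hr.le hz0
  have hsub1 : kCyl d 0 (ρ + r) ⊆ kCyl d 0 1 := kCyl_zero_mono d (by positivity) hρr
  have hL2 : normLinfL2 d g (kCyl d z0 r) ≤ √(M * A) :=
    normLinfL2_le_sqrt_mul d hg hg0 hBg (hsub.trans hsub1) hM0
      (ae_restrict_of_ae_restrict_of_subset hsub (ae_le_essSup_of_le hle))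
  have hLs : normLinf d s (kCyl d z0 r) ≤ S :=
    essSup_le_of_nonneg_of_ae_le (fun z => abs_nonneg _) hS0
      (ae_restrict_of_ae_restrict_of_subset (hsub.trans hsub1) (ae_le_essSup_of_le hBs))
  have hz1 : z0 ∈ kCyl d 0 1 := kCyl_zero_mono d hρ (by linarith) hz0
  have hr1 : r ≤ 1 := by linarith
  have hmain := hloc z0 hz1 r ⟨hr, hr1⟩ (hsub.trans hsub1)
  set p := r ^ (-(d:ℝ)/2) with hp
  have hp0 : 0 < p := Real.rpow_pos_of_pos hr _
  have hpsq : p ^ 2 = (r⁻¹) ^ d := by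
    rw [hp, ← Real.rpow_natCast, ← Real.rpow_mul hr.le, inv_pow, ← Real.rpow_natCast r d,
      ← Real.rpow_neg hr.le]
    congr 1
    push_cast
    ring
  have hyoung : C0 * (p * √(M * A)) ≤ ε * M + C0 ^ 2 * (r⁻¹) ^ d / (4 * ε) * A := by
    rw [← hpsq, Real.sqrt_mul hM0]
    have hm := Real.sq_sqrt hM0
    have ha := Real.sq_sqrt hA0
    set m := √M
    set a := √A
    rw [← hm, ← ha]
    have : ε * m ^ 2 + C0 ^ 2 * p ^ 2 / (4 * ε) * a ^ 2 - C0 * (p * (m * a))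
        = (2 * ε * m - C0 * p * a) ^ 2 / (4 * ε) := by
      field_simp
      ring
    have : 0 ≤ (2 * ε * m - C0 * p * a) ^ 2 / (4 * ε) := by positivity
    linarith
  have hrS : r ^ 2 * normLinf d s (kCyl d z0 r) ≤ S :=
    (mul_le_mul_of_nonneg_left hLs (by positivity)).trans
      (mul_le_of_le_one_left hS0 (pow_le_one₀ hr.le hr1))
  have hfin : essSup g (volume.restrict (kCyl d z0 (r/2))) ≤
      ε * M + (C0 ^ 2 * (r⁻¹) ^ d / (4 * ε) * A + C0 * S) := by
    refine hmain.trans ?_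
    have h1 : C0 * (p * normLinfL2 d g (kCyl d z0 r)) ≤ C0 * (p * √(M * A)) := by gcongr
    have h2 := mul_le_mul_of_nonneg_left hrS hC0.le
    linarith
  filter_upwards [ae_le_essSup_of_le (μ := volume.restrict (kCyl d z0 (r/2))) hle] with z hz
  exact hz.trans hfin

/-- Absorption: a bounded sequence with `a k ≤ 2^{-(d+1)} a (k+1) + 2^{dk} D` satisfies
`a 0 ≤ 2 D`. -/
lemma le_two_mul_of_absorb (d : ℕ) {a : ℕ → ℝ} {B D : ℝ} (hB : ∀ k, a k ≤ B) (hD : 0 ≤ D)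
    (h : ∀ k, a k ≤ (1 / 2) ^ (d + 1) * a (k + 1) + (2 ^ d) ^ k * D) : a 0 ≤ 2 * D := by
  have key : ∀ N, a 0 ≤ ((1 / 2) ^ (d + 1)) ^ N * a N + 2 * (1 - (1 / 2) ^ N) * D := by
    intro N
    induction N with
    | zero => simp
    | succ N ih =>
      have h1 := mul_le_mul_of_nonneg_left (h N)
        (by positivity : (0:ℝ) ≤ ((1 / 2) ^ (d + 1)) ^ N)
      have h2 : (((1:ℝ) / 2) ^ (d + 1)) ^ N * (2 ^ d) ^ N = (1 / 2) ^ N := by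
        rw [← mul_pow, pow_succ, mul_right_comm, ← mul_pow]
        norm_num
      refine ih.trans ?_
      rw [mul_add, ← mul_assoc, ← mul_assoc, h2] at h1
      rw [pow_succ _ N, pow_succ ((1:ℝ) / 2) N]
      linarith
  have hlim : Filter.Tendsto (fun N : ℕ => (((1:ℝ) / 2) ^ (d + 1)) ^ N * B + 2 * D)
      Filter.atTop (nhds (0 * B + 2 * D)) := by
    refine Filter.Tendsto.add_const _ (Filter.Tendsto.mul_const _ ?_)
    exact tendsto_pow_atTop_nhds_zero_of_lt_one (by positivity)
      (pow_lt_one₀ (by norm_num) (by norm_num) (by omega))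
  rw [zero_mul, zero_add] at hlim
  refine ge_of_tendsto' hlim fun N => (key N).trans ?_
  have h1 : ((1 / 2) ^ (d + 1)) ^ N * a N ≤ (((1:ℝ) / 2) ^ (d + 1)) ^ N * B :=
    mul_le_mul_of_nonneg_left (hB N) (by positivity)
  have h2 : 0 ≤ ((1:ℝ) / 2) ^ N * D := by positivity
  linarith

/-- **Proposition 3.2 (local `L^∞` estimate via interpolation).** Suppose `g ≥ 0` and `s`
are bounded measurable on `Q_1` (here: on `ℝ × ℝ^d × ℝ^d`), and the scaled local estimate
`ess sup_{Q_{r/2}(z0)} g ≤ C0 (r^{-d/2} ‖g‖_{L^∞_{t,x}L²_v(Q_r(z0))} + r² ‖s‖_{L^∞(Q_r(z0))})`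
holds for every `z0 ∈ Q_1` and `r ∈ (0,1]` with `Q_r(z0) ⊆ Q_1`. Then
`ess sup_{Q_{1/2}} g ≤ C (‖g‖_{L^∞_{t,x}L¹_v(Q_1)} + ‖s‖_{L^∞(Q_1)})` with `C = C(d, C0)`. -/
theorem local_Linfty_L1_estimate (d : ℕ) (hd : 1 ≤ d) (C0 : ℝ) (hC0 : 0 < C0) :
    ∃ C : ℝ, 0 < C ∧ ∀ g s : ℝ × V d × V d → ℝ,
      Measurable g → Measurable s → (∀ z, 0 ≤ g z) →
      (∃ B : ℝ, ∀ z, |g z| ≤ B ∧ |s z| ≤ B) →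
      (∀ z0 ∈ kCyl d 0 1, ∀ r ∈ Set.Ioc (0:ℝ) 1, kCyl d z0 r ⊆ kCyl d 0 1 →
        essSup g (volume.restrict (kCyl d z0 (r/2)))
          ≤ C0 * (r ^ (-(d:ℝ)/2) * normLinfL2 d g (kCyl d z0 r)
              + r ^ 2 * normLinf d s (kCyl d z0 r))) →
      essSup g (volume.restrict (kCyl d 0 (1/2)))
        ≤ C * (normLinfL1 d g (kCyl d 0 1) + normLinf d s (kCyl d 0 1)) := by
  refine ⟨2 * (C0 ^ 2 * 4 ^ d / (4 * (1 / 2) ^ (d + 1)) + C0), by positivity, ?_⟩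
  rintro g s hg - hg0 ⟨B, hB⟩ hloc
  set A := normLinfL1 d g (kCyl d 0 1)
  set S := normLinf d s (kCyl d 0 1)
  have hA0 : 0 ≤ A := essSup_nonneg_of_nonneg fun q => integral_nonneg fun v => abs_nonneg _
  have hS0 : 0 ≤ S := essSup_nonneg_of_nonneg fun z => abs_nonneg _
  have hB0 : 0 ≤ B := (abs_nonneg _).trans (hB 0).1
  set P := C0 ^ 2 * 4 ^ d / (4 * (1 / 2) ^ (d + 1)) with hP
  have hP0 : 0 ≤ P := by positivity
  have habs := le_two_mul_of_absorb d (B := B) (D := P * A + C0 * S)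
    (a := fun k => essSup g (volume.restrict (kCyl d 0 (1 - (1 / 2) ^ (k + 1)))))
    (fun k => essSup_le_of_nonneg_of_ae_le hg0 hB0
      (Filter.Eventually.of_forall fun z => (le_abs_self _).trans (hB z).1))
    (by positivity) (fun k => ?_)
  · norm_num at habs ⊢
    refine habs.trans ?_
    nlinarith [mul_nonneg hP0 hS0, mul_nonneg hC0.le hA0]
  · have hk : ((1:ℝ) / 2) ^ (k + 1) ≤ 1 := pow_le_one₀ (by norm_num) (by norm_num)
    have hk2 : (0:ℝ) < (1 / 2) ^ (k + 2) := by positivity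
    have hadd : 1 - ((1:ℝ) / 2) ^ (k + 1) + (1 / 2) ^ (k + 2) = 1 - (1 / 2) ^ (k + 1 + 1) := by
      ring
    have hstep := essSup_kCyl_le_of_local_estimate d hC0 hg hg0 (fun z => (hB z).1)
      (fun z => (hB z).2) hloc (ρ := 1 - (1 / 2) ^ (k + 1)) (r := (1 / 2) ^ (k + 2))
      (ε := (1 / 2) ^ (d + 1)) (by linarith) hk2
      (by rw [hadd]; linarith [show (0:ℝ) < (1 / 2) ^ (k + 1 + 1) by positivity]) (by positivity)
    rw [hadd] at hstep
    refine hstep.trans (add_le_add_right ?_ _)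
    have hpow : ((((1:ℝ) / 2) ^ (k + 2))⁻¹) ^ d = (2 ^ d) ^ k * 4 ^ d := by
      rw [← inv_pow, one_div, inv_inv, pow_add, mul_pow, ← pow_mul, ← pow_mul, mul_comm k d,
        pow_mul, pow_mul]
      norm_num
    have h1 : (1:ℝ) ≤ (2 ^ d) ^ k := one_le_pow₀ (one_le_pow₀ (by norm_num))
    have h2 := mul_le_mul_of_nonneg_right h1 (mul_nonneg hC0.le hS0)
    have h3 : C0 ^ 2 * ((((1:ℝ) / 2) ^ (k + 2))⁻¹) ^ d / (4 * (1 / 2) ^ (d + 1))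
        = (2 ^ d) ^ k * P := by
      rw [hpow, hP]
      ring
    rw [h3]
    linarith
end
end

section
/- Let d ≥ 1 be an integer, γ ∈ (−2, 0), and 0 < c1 ≤ C1. There exist constants 0 < λ ≤ Λ, depending only on d, γ, c1, C1, such that the following holds. Let v0 ∈ ℝ^d with |v0| ≥ 2, set e0 = v0/|v0|, and let a be a symmetric positive semidefinite d×d matrix satisfying: (i) a w·w ≤ C1 (1+|v0|)^{γ+2} |w|² for all w ∈ ℝ^d; (ii) a e0·e0 ≤ C1 (1+|v0|)^γ; (iii) a w·w ≥ c1 (1+|v0|)^γ |w|² for all w ∈ ℝ^d; (iv) a w·w ≥ c1 (1+|v0|)^{γ+2} |w|² for all w ∈ ℝ^d with w·v0 = 0. Then the matrix A = T^{−1} a T^{−1}, where T is the linear map with T e = |v0|^{1+γ/2} e for e ⊥ v0 and T e = |v0|^{γ/2} e for e parallel to v0, satisfies λ |w|² ≤ A w·w ≤ Λ |w|² for all w ∈ ℝ^d. -/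
open MeasureTheory Real Set
open scoped RealInnerProductSpace

noncomputable section

/-- The anisotropic linear map acting as multiplication by `s` on the span of `v0`
and by `t` on its orthogonal complement. -/
noncomputable def aniso (d : ℕ) (s t : ℝ) (v0 v : V d) : V d :=
  s • ((⟪v0, v⟫ / ‖v0‖ ^ 2) • v0) + t • (v - (⟪v0, v⟫ / ‖v0‖ ^ 2) • v0)

/-- The map `T = T_{v0}`: multiplication by `|v0|^{γ/2}` on the span of `v0` and by
`|v0|^{1+γ/2}` on its orthogonal complement. -/
noncomputable def Tmap (d : ℕ) (γ : ℝ) (v0 : V d) : V d → V d :=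
  aniso d (‖v0‖ ^ (γ / 2)) (‖v0‖ ^ (1 + γ / 2)) v0

/-- The inverse map `T⁻¹ = T_{v0}⁻¹`. -/
noncomputable def TmapInv (d : ℕ) (γ : ℝ) (v0 : V d) : V d → V d :=
  aniso d (‖v0‖ ^ (-(γ / 2))) (‖v0‖ ^ (-(1 + γ / 2))) v0

/-- The quadratic form `a w · w` of a `d × d` matrix. -/
noncomputable def qf (d : ℕ) (a : Matrix (Fin d) (Fin d) ℝ) (w : V d) : ℝ :=
  ∑ i : Fin d, ∑ j : Fin d, a i j * w i * w j

theorem qf_smul {d : ℕ} (a : Matrix (Fin d) (Fin d) ℝ) (k : ℝ) (w : V d) :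
    qf d a (k • w) = k ^ 2 * qf d a w := by
  simp only [qf, Finset.mul_sum, PiLp.smul_apply, smul_eq_mul]
  refine Finset.sum_congr rfl fun i _ => Finset.sum_congr rfl fun j _ => ?_
  ring

theorem qf_parallelogram {d : ℕ} (a : Matrix (Fin d) (Fin d) ℝ) (x y : V d) :
    qf d a (x + y) + qf d a (x - y) = 2 * qf d a x + 2 * qf d a y := by
  simp only [qf, Finset.mul_sum, ← Finset.sum_add_distrib, PiLp.add_apply, PiLp.sub_apply]
  refine Finset.sum_congr rfl fun i _ => Finset.sum_congr rfl fun j _ => ?_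
  ring

theorem qf_add_le {d : ℕ} {a : Matrix (Fin d) (Fin d) ℝ} (ha : ∀ w : V d, 0 ≤ qf d a w)
    (x y : V d) : qf d a (x + y) ≤ 2 * qf d a x + 2 * qf d a y := by
  linarith [qf_parallelogram a x y, ha (x - y)]

theorem qf_sub_le {d : ℕ} {a : Matrix (Fin d) (Fin d) ℝ} (ha : ∀ w : V d, 0 ≤ qf d a w)
    (x y : V d) : qf d a (x - y) ≤ 2 * qf d a x + 2 * qf d a y := by
  linarith [qf_parallelogram a x y, ha (x + y)]

theorem rpow_mul_sq_rpow_neg_half {n : ℝ} (hn : 0 < n) (β : ℝ) :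
    (1 + n) ^ β * (n ^ (-(β / 2))) ^ 2 = ((1 + n) / n) ^ β := by
  rw [← Real.rpow_natCast (n ^ (-(β / 2))), ← Real.rpow_mul hn.le,
    Real.div_rpow (by positivity) hn.le, div_eq_mul_inv ((1 + n) ^ β), ← Real.rpow_neg hn.le]
  congr 2
  push_cast
  ring

theorem one_le_one_add_div_self {n : ℝ} (hn : 0 < n) : 1 ≤ (1 + n) / n := by
  rw [le_div_iff₀ hn]
  linarith

theorem one_add_div_self_sq_le {n : ℝ} (hn : 2 ≤ n) : ((1 + n) / n) ^ (2 : ℝ) ≤ 9 / 4 := by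
  have h : (1 + n) / n ≤ 3 / 2 := by
    rw [div_le_iff₀ (by linarith)]
    linarith
  have h0 : 0 ≤ (1 + n) / n := by positivity
  rw [Real.rpow_two]
  nlinarith

/-- For a positive semidefinite form, an upper bound on `x` and a lower bound on `x + y` and on `y`
control `x` and `y` separately by the value at `x + y`. -/
theorem add_le_qf_add {d : ℕ} {a : Matrix (Fin d) (Fin d) ℝ} (ha : ∀ w : V d, 0 ≤ qf d a w)
    {c C X Y : ℝ} (hc : 0 < c) (hC : 0 ≤ C) {x y : V d} (hx : qf d a x ≤ C * X)
    (hxy : c * X ≤ qf d a (x + y)) (hy : c * Y ≤ qf d a y) :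
    c ^ 2 * (X + Y) ≤ (3 * c + 2 * C) * qf d a (x + y) := by
  have h := qf_sub_le ha (x + y) x
  rw [add_sub_cancel_left] at h
  nlinarith [mul_le_mul_of_nonneg_left hxy hC]

/-- **Lemma 4.1(b), uniform ellipticity after the change of variables.** If a symmetric
positive semidefinite matrix `a` satisfies the anisotropic upper and lower bounds of the
Landau diffusion matrix at `v0` (with `|v0| ≥ 2`), then `A = T⁻¹ a T⁻¹` is uniformly
elliptic: `λ |w|² ≤ A w·w ≤ Λ |w|²`, with `λ, Λ` depending only on `d, γ, c1, C1`.
(The quadratic form of `A = T⁻¹ a T⁻¹` is `w ↦ a (T⁻¹ w)·(T⁻¹ w)` since `T` is symmetric.) -/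
theorem uniform_ellipticity (d : ℕ) (hd : 1 ≤ d) (γ : ℝ) (hγ : γ ∈ Set.Ioo (-2:ℝ) 0)
    (c1 C1 : ℝ) (hc1 : 0 < c1) (hc1C1 : c1 ≤ C1) :
    ∃ lam Lam : ℝ, 0 < lam ∧ lam ≤ Lam ∧ ∀ v0 : V d, 2 ≤ ‖v0‖ →
      ∀ a : Matrix (Fin d) (Fin d) ℝ, a.IsSymm → (∀ w : V d, 0 ≤ qf d a w) →
      (∀ w : V d, qf d a w ≤ C1 * (1 + ‖v0‖) ^ (γ + 2) * ‖w‖ ^ 2) →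
      qf d a (‖v0‖⁻¹ • v0) ≤ C1 * (1 + ‖v0‖) ^ γ →
      (∀ w : V d, c1 * (1 + ‖v0‖) ^ γ * ‖w‖ ^ 2 ≤ qf d a w) →
      (∀ w : V d, ⟪w, v0⟫ = 0 → c1 * (1 + ‖v0‖) ^ (γ + 2) * ‖w‖ ^ 2 ≤ qf d a w) →
      ∀ w : V d,
        lam * ‖w‖ ^ 2 ≤ qf d a (TmapInv d γ v0 w) ∧
        qf d a (TmapInv d γ v0 w) ≤ Lam * ‖w‖ ^ 2 := by
  have hC1 : 0 < C1 := hc1.trans_le hc1C1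
  refine ⟨c1 ^ 2 / (9 / 4 * (3 * c1 + 2 * C1)), 9 / 2 * C1, by positivity, ?_, ?_⟩
  · rw [div_le_iff₀ (by positivity)]
    nlinarith
  intro v0 hv0 a _ hpos hup hupe hlow hlowp w
  obtain ⟨hγ1, hγ2⟩ := hγ
  have hn : 0 < ‖v0‖ := by linarith
  set n := ‖v0‖ with hn_def
  set μ := ⟪v0, w⟫ / n ^ 2 with hμ
  set q := w - μ • v0 with hq
  set s := n ^ (-(γ / 2)) with hs
  set t := n ^ (-(1 + γ / 2)) with ht
  have hT : TmapInv d γ v0 w = s • (μ • v0) + t • q := rfl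
  have horth : ⟪q, v0⟫ = 0 := by
    rw [hq, inner_sub_left, real_inner_smul_left, real_inner_self_eq_norm_sq, ← hn_def, hμ,
      div_mul_cancel₀ _ (by positivity), real_inner_comm, sub_self]
  have hnorm (k l : ℝ) : ‖k • (μ • v0) + l • q‖ ^ 2 = k ^ 2 * (μ * n) ^ 2 + l ^ 2 * ‖q‖ ^ 2 := by
    rw [norm_add_sq_real]
    simp only [real_inner_smul_left, real_inner_smul_right, norm_smul, mul_pow, Real.norm_eq_abs,
      sq_abs]
    rw [real_inner_comm, horth]
    ring
  have hw : ‖w‖ ^ 2 = (μ * n) ^ 2 + ‖q‖ ^ 2 := by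
    have h := hnorm 1 1
    simpa [hq] using h
  have hr1 : 1 ≤ (1 + n) / n := one_le_one_add_div_self hn
  have hr0 : 0 < (1 + n) / n := by positivity
  have hr2 := one_add_div_self_sq_le hv0
  have hS : (1 + n) ^ γ * s ^ 2 = ((1 + n) / n) ^ γ := rpow_mul_sq_rpow_neg_half hn γ
  have hR : (1 + n) ^ (γ + 2) * t ^ 2 = ((1 + n) / n) ^ (γ + 2) := by
    rw [← rpow_mul_sq_rpow_neg_half hn (γ + 2), ht]
    ring_nf
  have hS1 : (1 + n) ^ γ * s ^ 2 ≤ 1 := hS ▸ Real.rpow_le_one_of_one_le_of_nonpos hr1 hγ2.le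
  have hR1 : 1 ≤ (1 + n) ^ (γ + 2) * t ^ 2 := hR ▸ Real.one_le_rpow hr1 (by linarith)
  have hR2 : (1 + n) ^ (γ + 2) * t ^ 2 ≤ 9 / 4 :=
    hR ▸ (Real.rpow_le_rpow_of_exponent_le hr1 (by linarith)).trans hr2
  have hS2 : 1 ≤ 9 / 4 * ((1 + n) ^ γ * s ^ 2) := by
    have h1 : 1 ≤ ((1 + n) / n) ^ (γ + 2) := Real.one_le_rpow hr1 (by linarith)
    rw [Real.rpow_add hr0] at h1
    rw [hS]
    nlinarith [Real.rpow_pos_of_pos hr0 γ]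
  have hx : qf d a (s • (μ • v0)) ≤ C1 * ((1 + n) ^ γ * s ^ 2 * (μ * n) ^ 2) := by
    have h : s • (μ • v0) = (s * (μ * n)) • (n⁻¹ • v0) := by
      rw [smul_smul, smul_smul]
      congr 1
      field_simp
    rw [h, qf_smul]
    calc (s * (μ * n)) ^ 2 * qf d a (n⁻¹ • v0)
        ≤ (s * (μ * n)) ^ 2 * (C1 * (1 + n) ^ γ) := by gcongr
      _ = _ := by ring
  have hlowx : c1 * ((1 + n) ^ γ * s ^ 2 * (μ * n) ^ 2) ≤ qf d a (s • (μ • v0) + t • q) := by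
    have h := hlow (s • (μ • v0) + t • q)
    rw [hnorm] at h
    have h' : 0 ≤ c1 * (1 + n) ^ γ * (t ^ 2 * ‖q‖ ^ 2) := by positivity
    linarith
  have hlowy : c1 * ((1 + n) ^ (γ + 2) * t ^ 2 * ‖q‖ ^ 2) ≤ qf d a (t • q) := by
    rw [qf_smul]
    linarith [mul_le_mul_of_nonneg_left (hlowp q horth) (sq_nonneg t)]
  have hupy : qf d a (t • q) ≤ C1 * ((1 + n) ^ (γ + 2) * t ^ 2 * ‖q‖ ^ 2) := by
    rw [qf_smul]
    linarith [mul_le_mul_of_nonneg_left (hup q) (sq_nonneg t)]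
  rw [hT, hw]
  have hp2 : 0 ≤ (μ * n) ^ 2 := sq_nonneg _
  have hq2 : 0 ≤ ‖q‖ ^ 2 := sq_nonneg _
  constructor
  · have h := add_le_qf_add hpos hc1 hC1.le hx hlowx hlowy
    have hsum : (μ * n) ^ 2 + ‖q‖ ^ 2 ≤ 9 / 4 * ((1 + n) ^ γ * s ^ 2 * (μ * n) ^ 2 +
        (1 + n) ^ (γ + 2) * t ^ 2 * ‖q‖ ^ 2) := by
      linarith [mul_le_mul_of_nonneg_right hS2 hp2, mul_le_mul_of_nonneg_right hR1 hq2]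
    have h4 := mul_le_mul_of_nonneg_left hsum (sq_nonneg c1)
    have hc : 0 < 9 / 4 * (3 * c1 + 2 * C1) := by linarith
    rw [div_mul_eq_mul_div, div_le_iff₀ hc]
    linarith
  · have h := qf_add_le hpos (s • (μ • v0)) (t • q)
    have h1 := mul_le_mul_of_nonneg_left (mul_le_mul_of_nonneg_right hS1 hp2) hC1.le
    have h2 := mul_le_mul_of_nonneg_left (mul_le_mul_of_nonneg_right hR2 hq2) hC1.le
    have h3 := mul_nonneg hC1.le hp2
    linarith
end
end

section
/- Let d ≥ 1 be an integer, γ ∈ (−2, 0), and let c, C > 0. There exists c' > 0, depending only on d, γ, c, C, such that the following holds. Let v0, ṽ ∈ ℝ^d with |v0| ≥ 2 and |ṽ − v0| ≤ 1, and let a be a symmetric positive semidefinite d×d matrix satisfying: (i) a w·w ≥ c (1+|v0|)^{γ+2} |w|² for all w ∈ ℝ^d with w·ṽ = 0; (ii) a w·w ≥ c (1+|v0|)^γ |w|² for all w ∈ ℝ^d; and (iii) a ṽ·ṽ ≤ C (1+|v0|)^γ |ṽ|². Then a w·w ≥ c' (1+|v0|)^{γ+2} |w|² for all w ∈ ℝ^d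 with w·v0 = 0. -/
open MeasureTheory Real Set
open scoped RealInnerProductSpace

noncomputable section

/-- The parallelogram-type identity for the quadratic form `qf`. -/
theorem qf_sub_smul_add_qf_add_smul (d : ℕ) (a : Matrix (Fin d) (Fin d) ℝ) (s : ℝ) (w v : V d) :
    qf d a (w - s • v) + qf d a (w + s • v) = 2 * qf d a w + 2 * s ^ 2 * qf d a v := by
  simp only [qf, Finset.mul_sum, ← Finset.sum_add_distrib]
  refine Finset.sum_congr rfl fun i _ => Finset.sum_congr rfl fun j _ => ?_
  simp only [PiLp.sub_apply, PiLp.add_apply, PiLp.smul_apply, smul_eq_mul]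
  ring

/-- **Step in the proof of Lemma 4.1: transfer of the degenerate lower bound from
directions orthogonal to `ṽ` to directions orthogonal to `v0`.** -/
theorem orthogonal_lower_bound_transfer (d : ℕ) (hd : 1 ≤ d) (γ : ℝ)
    (hγ : γ ∈ Set.Ioo (-2:ℝ) 0) (c C : ℝ) (hc : 0 < c) (hC : 0 < C) :
    ∃ c' : ℝ, 0 < c' ∧ ∀ v0 vt : V d, 2 ≤ ‖v0‖ → ‖vt - v0‖ ≤ 1 →
      ∀ a : Matrix (Fin d) (Fin d) ℝ, a.IsSymm → (∀ w : V d, 0 ≤ qf d a w) →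
      (∀ w : V d, ⟪w, vt⟫ = 0 → c * (1 + ‖v0‖) ^ (γ + 2) * ‖w‖ ^ 2 ≤ qf d a w) →
      (∀ w : V d, c * (1 + ‖v0‖) ^ γ * ‖w‖ ^ 2 ≤ qf d a w) →
      qf d a vt ≤ C * (1 + ‖v0‖) ^ γ * ‖vt‖ ^ 2 →
      ∀ w : V d, ⟪w, v0⟫ = 0 → c' * (1 + ‖v0‖) ^ (γ + 2) * ‖w‖ ^ 2 ≤ qf d a w := by
  set M : ℝ := 18 + 72 * (C / c) with hM
  have hCc : 0 < C / c := div_pos hC hc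
  have hM0 : 0 < M := by positivity
  refine ⟨c / M, by positivity, ?_⟩
  intro v0 vt hv0 hvt a _ hpos hperp hall hdir w hw
  set R : ℝ := 1 + ‖v0‖ with hR
  have hR3 : 3 ≤ R := by linarith
  have hR0 : 0 < R := by linarith
  set P : ℝ := R ^ γ with hP
  have hP0 : 0 < P := Real.rpow_pos_of_pos hR0 γ
  have hpow : R ^ (γ + 2) = P * R ^ 2 := by
    rw [Real.rpow_add hR0, Real.rpow_two]
  rw [hpow] at hperp ⊢
  have hcM : c / M * M = c := by field_simp
  have hcM0 : 0 < c / M := by positivity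
  rcases le_total (R ^ 2) M with hsmall | hlarge
  · refine le_trans ?_ (hall w)
    have : c / M * (P * R ^ 2) ≤ c * P := by
      calc c / M * (P * R ^ 2) ≤ c / M * (P * M) := by gcongr
        _ = c * P := by rw [mul_left_comm, hcM, mul_comm]
    gcongr
  · have hnorm : R / 3 ≤ ‖vt‖ := by
      have h := norm_sub_norm_le v0 vt
      rw [norm_sub_rev] at h
      linarith
    have hvt0 : 0 < ‖vt‖ := by linarith
    have hN : R ^ 2 / 9 ≤ ‖vt‖ ^ 2 := by nlinarith
    have hinner : ⟪w, vt⟫ ^ 2 ≤ ‖w‖ ^ 2 := by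
      have h1 : ⟪w, vt⟫ = ⟪w, vt - v0⟫ := by rw [inner_sub_right, hw, sub_zero]
      have h2 : |⟪w, vt⟫| ≤ ‖w‖ := by
        rw [h1]
        exact (abs_real_inner_le_norm _ _).trans (mul_le_of_le_one_right (norm_nonneg _) hvt)
      exact sq_le_sq.2 (by rwa [abs_norm])
    set s : ℝ := ⟪w, vt⟫ / ‖vt‖ ^ 2 with hs
    have hsN : s * ‖vt‖ ^ 2 = ⟪w, vt⟫ := by rw [hs]; field_simp
    have horth : ⟪w - s • vt, vt⟫ = 0 := by
      rw [inner_sub_left, real_inner_smul_left, real_inner_self_eq_norm_sq, hsN, sub_self]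
    have hu : ‖w - s • vt‖ ^ 2 = ‖w‖ ^ 2 - s ^ 2 * ‖vt‖ ^ 2 := by
      rw [norm_sub_sq_real, real_inner_smul_right, norm_smul, mul_pow, Real.norm_eq_abs, sq_abs,
        ← hsN]
      ring
    have hX : s ^ 2 * ‖vt‖ ^ 2 * R ^ 2 ≤ 9 * ‖w‖ ^ 2 := by
      have h1 : (s ^ 2 * ‖vt‖ ^ 2) * (R ^ 2 / 9) ≤ (s ^ 2 * ‖vt‖ ^ 2) * ‖vt‖ ^ 2 := by gcongr
      have h2 : (s ^ 2 * ‖vt‖ ^ 2) * ‖vt‖ ^ 2 = ⟪w, vt⟫ ^ 2 := by rw [← hsN]; ring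
      linarith
    have hid := qf_sub_smul_add_qf_add_smul d a s w vt
    have hplus := hpos (w + s • vt)
    have hminus := hperp _ horth
    rw [hu] at hminus
    have hdir' : s ^ 2 * qf d a vt ≤ C * P * (s ^ 2 * ‖vt‖ ^ 2) := by
      calc s ^ 2 * qf d a vt ≤ s ^ 2 * (C * P * ‖vt‖ ^ 2) := by gcongr
        _ = C * P * (s ^ 2 * ‖vt‖ ^ 2) := by ring
    set X : ℝ := s ^ 2 * ‖vt‖ ^ 2 with hXdef
    have hX0 : 0 ≤ X := by positivity
    have hR18 : 18 ≤ R ^ 2 := by linarith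
    have hCR : 72 * C ≤ c * R ^ 2 := by
      have h1 : c * (72 * (C / c)) = 72 * C := by field_simp
      have h2 : c * (72 * (C / c)) ≤ c * R ^ 2 := by gcongr; linarith
      linarith
    have hXhalf : X ≤ ‖w‖ ^ 2 / 2 := by nlinarith
    have hmain : c * (P * R ^ 2) * (‖w‖ ^ 2 / 2) ≤ c * (P * R ^ 2) * (‖w‖ ^ 2 - X) := by
      gcongr
      linarith
    have herr : C * P * X ≤ c * (P * R ^ 2) * ‖w‖ ^ 2 / 8 := by
      have h1 : P * X * (72 * C) ≤ P * X * (c * R ^ 2) := by gcongr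
      have h2 : c * P * (X * R ^ 2) ≤ c * P * (9 * ‖w‖ ^ 2) := by gcongr
      have h3 : c * P * ‖w‖ ^ 2 * 1 ≤ c * P * ‖w‖ ^ 2 * R ^ 2 := by gcongr; linarith
      linarith
    have hfin : c / M * (P * R ^ 2) * ‖w‖ ^ 2 ≤ c / 8 * (P * R ^ 2) * ‖w‖ ^ 2 := by
      gcongr
      linarith
    linarith
end
end

section
/- Let d ≥ 1 be an integer, T0 > 0, and let Ω ⊂ ℝ^d × ℝ^d be a bounded open set; set Q = [0,T0] × Ω. Let 0 < λ ≤ Λ, and let a : Q → (d×d symmetric matrices), b : Q → ℝ^d, c : Q → ℝ be measurable with λ|w|² ≤ a(t,x,v) w·w ≤ Λ|w|² for all w ∈ ℝ^d, |b| ≤ Λ, and |c| ≤ Λ on Q. Let g : Q → ℝ be continuous on the closure of Q, C¹ in (t,x) and C² in v on (0,T0] × Ω, and satisfy pointwise ∂_t g + v·∇_x g ≤ tr(a D_v² g) + b·∇_v g + c g on (0,T0] × Ω. If g ≤ 0 on ({0} × Ω) ∪ ([0,T0] × ∂Ω), then g ≤ 0 on all of Q. -/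
open MeasureTheory Real Set
open scoped RealInnerProductSpace

noncomputable section

/-- The second directional derivative is nonpositive at an interior local maximum. -/
theorem IsLocalMax.fderiv_fderiv_apply_nonpos {E : Type*} [NormedAddCommGroup E]
    [NormedSpace ℝ E] {f : E → ℝ} {x : E} (hmax : IsLocalMax f x) (hf : ContDiffAt ℝ 2 f x)
    (w : E) : fderiv ℝ (fderiv ℝ f) x w w ≤ 0 := by
  have hline : ∀ s : ℝ, HasDerivAt (fun s : ℝ => x + s • w) w s := fun s => by
    simpa using ((hasDerivAt_id s).smul_const w).const_add x
  have hcont : Filter.Tendsto (fun s : ℝ => x + s • w) (nhds 0) (nhds x) := by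
    simpa [ContinuousAt] using (hline 0).continuousAt
  have hdiff : DifferentiableAt ℝ (fderiv ℝ f) x :=
    (hf.fderiv_right (m := 1) (by norm_num)).differentiableAt (by norm_num)
  have hev : ∀ᶠ y in nhds x, DifferentiableAt ℝ f y :=
    (hf.eventually (by simp)).mono fun y hy => hy.differentiableAt (by norm_num)
  have hderiv : deriv (fun s : ℝ => f (x + s • w)) =ᶠ[nhds 0]
      fun s => fderiv ℝ f (x + s • w) w := by
    filter_upwards [hcont.eventually hev] with s hs
    exact (hs.hasFDerivAt.comp_hasDerivAt s (hline s)).deriv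
  have hx0 : x + (0 : ℝ) • w = x := by simp
  have hsecond : HasDerivAt (fun s : ℝ => fderiv ℝ f (x + s • w) w)
      (fderiv ℝ (fderiv ℝ f) x w w) 0 := by
    have h : HasDerivAt (fun s : ℝ => fderiv ℝ f (x + s • w)) (fderiv ℝ (fderiv ℝ f) x w) 0 :=
      hdiff.hasFDerivAt.comp_hasDerivAt_of_eq (0 : ℝ) (hline 0) hx0.symm
    simpa using h.clm_apply (hasDerivAt_const (0 : ℝ) w)
  have hdd : deriv (deriv fun s : ℝ => f (x + s • w)) 0 = fderiv ℝ (fderiv ℝ f) x w w := by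
    rw [hderiv.deriv_eq, hsecond.deriv]
  by_contra! hpos
  have hmax' : ∀ᶠ s : ℝ in nhds 0, f (x + s • w) ≤ f (x + (0 : ℝ) • w) := by
    rw [hx0]; exact hcont.eventually hmax
  have hmin : IsLocalMin (fun s : ℝ => f (x + s • w)) 0 := by
    refine isLocalMin_of_deriv_deriv_pos (by rw [hdd]; exact hpos)
      (IsLocalMax.deriv_eq_zero hmax') ?_
    have h : ContinuousAt f (x + (0 : ℝ) • w) := by rw [hx0]; exact hf.continuousAt
    exact ContinuousAt.comp (f := fun s : ℝ => x + s • w) h (hline 0).continuousAt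
  have hconst : (fun s : ℝ => f (x + s • w)) =ᶠ[nhds 0] fun _ => f (x + (0 : ℝ) • w) := by
    filter_upwards [hmax', hmin] with s h1 h2 using le_antisymm h1 h2
  have hzero : deriv (deriv fun s : ℝ => f (x + s • w)) 0 = 0 := by
    rw [hconst.deriv.deriv_eq]; simp
  rw [hdd] at hzero
  exact hpos.ne' hzero

theorem pd2_eq_fderiv_fderiv {d : ℕ} {φ : V d → ℝ} {v : V d} (hφ : ContDiffAt ℝ 2 φ v)
    (i j : Fin d) :
    pd2 φ v i j =
      fderiv ℝ (fderiv ℝ φ) v (EuclideanSpace.single i 1) (EuclideanSpace.single j 1) := by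
  have hdiff : DifferentiableAt ℝ (fderiv ℝ φ) v :=
    (hφ.fderiv_right (m := 1) (by norm_num)).differentiableAt (by norm_num)
  have h := hdiff.hasFDerivAt.clm_apply
    (hasFDerivAt_const (EuclideanSpace.single j (1 : ℝ)) v)
  rw [pd2, h.fderiv]
  simp

open scoped MatrixOrder in
/-- The trace of the product of a positive semidefinite matrix with a bilinear form that is
nonpositive on the diagonal is nonpositive. -/
theorem Matrix.PosSemidef.sum_mul_bilin_nonpos {d : ℕ} {A : Matrix (Fin d) (Fin d) ℝ}
    (hA : A.PosSemidef) (H : V d →L[ℝ] V d →L[ℝ] ℝ) (hH : ∀ w, H w w ≤ 0) :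
    ∑ i, ∑ j, A i j * H (EuclideanSpace.single i 1) (EuclideanSpace.single j 1) ≤ 0 := by
  obtain ⟨B, rfl⟩ := CStarAlgebra.nonneg_iff_eq_star_mul_self.mp hA.nonneg
  have hrow : ∀ k, H (∑ i, B k i • EuclideanSpace.single i (1 : ℝ))
      (∑ j, B k j • EuclideanSpace.single j (1 : ℝ)) =
      ∑ i, ∑ j, B k i * B k j *
        H (EuclideanSpace.single i 1) (EuclideanSpace.single j 1) := fun k => by
    simp only [map_sum, map_smul, _root_.sum_apply, _root_.smul_apply,
      smul_eq_mul, Finset.mul_sum, mul_assoc]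
    rw [Finset.sum_comm]
    refine Finset.sum_congr rfl fun i _ => Finset.sum_congr rfl fun j _ => by ring
  calc _ = ∑ k, H (∑ i, B k i • EuclideanSpace.single i (1 : ℝ))
        (∑ j, B k j • EuclideanSpace.single j (1 : ℝ)) := by
        simp only [hrow, Matrix.mul_apply, Matrix.star_eq_conjTranspose, Matrix.conjTranspose_apply, star_trivial,
          Finset.sum_mul]
        conv_rhs => rw [Finset.sum_comm]
        exact Finset.sum_congr rfl fun i _ => Finset.sum_comm
    _ ≤ 0 := Finset.sum_nonpos fun k _ => hH _

theorem posSemidef_of_qf_nonneg {d : ℕ} {A : Matrix (Fin d) (Fin d) ℝ} (hs : A.IsSymm)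
    (hA : ∀ w : V d, 0 ≤ qf d A w) : A.PosSemidef := by
  refine Matrix.PosSemidef.of_dotProduct_mulVec_nonneg (by simpa [Matrix.IsHermitian] using hs.eq)
    fun x => ?_
  refine (hA (WithLp.toLp 2 x)).trans_eq ?_
  simp only [qf, dotProduct, Matrix.mulVec, star_trivial, Finset.mul_sum, Pi.star_apply]
  exact Finset.sum_congr rfl fun i _ => Finset.sum_congr rfl fun j _ => by ring

/-- A function on `[0, t]` that is maximal at the right end point has nonnegative derivative
there. -/
theorem HasDerivAt.nonneg_of_forall_le_right {f : ℝ → ℝ} {f' t : ℝ} (ht : 0 < t)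
    (hf : HasDerivAt f f' t) (hmax : ∀ s ∈ Set.Icc 0 t, f s ≤ f t) : 0 ≤ f' := by
  have hloc : IsLocalMaxOn f (Set.Icc 0 t) t :=
    IsMaxOn.localize (f := f) fun s hs => hmax s hs
  have hmem : (0 - t) ∈ posTangentConeAt (Set.Icc 0 t) t := by
    refine sub_mem_posTangentConeAt_of_segment_subset ?_
    rw [segment_symm, segment_eq_Icc ht.le]
  have h := hloc.hasFDerivWithinAt_nonpos hf.hasFDerivAt.hasFDerivWithinAt hmem
  simp at h
  nlinarith

/-- **Proposition A.1 (maximum principle on a bounded domain).** For a kinetic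
Fokker-Planck operator with measurable, uniformly elliptic diffusion `a`, bounded drift
`b` and bounded zeroth-order coefficient `c` on `Q = [0,T0] × Ω` (`Ω ⊂ ℝ^{2d}` open and
bounded), any classical subsolution `g` which is `≤ 0` on the parabolic boundary
`({0} × Ω) ∪ ([0,T0] × ∂Ω)` satisfies `g ≤ 0` on all of `Q`. -/
theorem maximum_principle_bounded (d : ℕ) (hd : 1 ≤ d) (T0 : ℝ) (hT0 : 0 < T0)
    (Ω : Set (V d × V d)) (hΩo : IsOpen Ω) (hΩb : Bornology.IsBounded Ω)
    (lam Lam : ℝ) (hlam : 0 < lam) (hlL : lam ≤ Lam)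
    (a : ℝ → V d → V d → Matrix (Fin d) (Fin d) ℝ)
    (b : ℝ → V d → V d → V d) (c : ℝ → V d → V d → ℝ)
    (ha_meas : ∀ i j : Fin d, Measurable (fun z : ℝ × V d × V d => a z.1 z.2.1 z.2.2 i j))
    (hb_meas : Measurable (fun z : ℝ × V d × V d => b z.1 z.2.1 z.2.2))
    (hc_meas : Measurable (fun z : ℝ × V d × V d => c z.1 z.2.1 z.2.2))
    (ha_sym : ∀ t x v, (a t x v).IsSymm)
    (ha_ell : ∀ t ∈ Set.Icc (0:ℝ) T0, ∀ p ∈ Ω, ∀ w : V d,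
      lam * ‖w‖ ^ 2 ≤ qf d (a t p.1 p.2) w ∧ qf d (a t p.1 p.2) w ≤ Lam * ‖w‖ ^ 2)
    (hb_bdd : ∀ t ∈ Set.Icc (0:ℝ) T0, ∀ p ∈ Ω, ‖b t p.1 p.2‖ ≤ Lam)
    (hc_bdd : ∀ t ∈ Set.Icc (0:ℝ) T0, ∀ p ∈ Ω, |c t p.1 p.2| ≤ Lam)
    (g : ℝ → V d → V d → ℝ)
    (hg_cont : ContinuousOn (fun z : ℝ × V d × V d => g z.1 z.2.1 z.2.2)
      (closure (Set.Icc 0 T0 ×ˢ Ω)))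
    (hg_t : ∀ t ∈ Set.Ioc (0:ℝ) T0, ∀ p ∈ Ω, DifferentiableAt ℝ (fun s => g s p.1 p.2) t)
    (hg_x : ∀ t ∈ Set.Ioc (0:ℝ) T0, ∀ p ∈ Ω, DifferentiableAt ℝ (fun y => g t y p.2) p.1)
    (hg_v : ∀ t ∈ Set.Ioc (0:ℝ) T0, ∀ p ∈ Ω, ContDiffAt ℝ 2 (fun u => g t p.1 u) p.2)
    (hsub : ∀ t ∈ Set.Ioc (0:ℝ) T0, ∀ p ∈ Ω,
      deriv (fun s => g s p.1 p.2) t + fderiv ℝ (fun y => g t y p.2) p.1 p.2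
        ≤ (∑ i : Fin d, ∑ j : Fin d, a t p.1 p.2 i j * pd2 (fun u => g t p.1 u) p.2 i j)
          + fderiv ℝ (fun u => g t p.1 u) p.2 (b t p.1 p.2) + c t p.1 p.2 * g t p.1 p.2)
    (hbdry0 : ∀ p ∈ Ω, g 0 p.1 p.2 ≤ 0)
    (hbdry : ∀ t ∈ Set.Icc (0:ℝ) T0, ∀ p ∈ frontier Ω, g t p.1 p.2 ≤ 0) :
    ∀ t ∈ Set.Icc (0:ℝ) T0, ∀ p ∈ Ω, g t p.1 p.2 ≤ 0 := by
  have hK : IsCompact (Set.Icc (0:ℝ) T0 ×ˢ closure Ω) :=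
    isCompact_Icc.prod hΩb.isCompact_closure
  rw [closure_prod_eq, isClosed_Icc.closure_eq] at hg_cont
  intro t₀ ht₀ p₀ hp₀
  by_contra! hpos
  obtain ⟨⟨t, p⟩, ⟨ht, hp⟩, hmax⟩ := hK.exists_isMaxOn
    ⟨(t₀, p₀), ht₀, subset_closure hp₀⟩
    (f := fun z => Real.exp (-(Lam + 1) * z.1) * g z.1 z.2.1 z.2.2)
    (ContinuousOn.mul (by fun_prop) hg_cont)
  have hle : ∀ s ∈ Set.Icc (0:ℝ) T0, ∀ q ∈ closure Ω,
      Real.exp (-(Lam + 1) * s) * g s q.1 q.2 ≤ Real.exp (-(Lam + 1) * t) * g t p.1 p.2 :=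
    fun s hs q hq => hmax (Set.mk_mem_prod hs hq)
  have hgpos : 0 < g t p.1 p.2 :=
    pos_of_mul_pos_right ((mul_pos (Real.exp_pos _) hpos).trans_le
      (hle t₀ ht₀ p₀ (subset_closure hp₀))) (Real.exp_pos _).le
  have hpΩ : p ∈ Ω := by
    by_contra hn
    have hfr : p ∈ frontier Ω := by rw [hΩo.frontier_eq]; exact ⟨hp, hn⟩
    exact (hbdry t ht p hfr).not_gt hgpos
  have htpos : 0 < t := by
    refine ht.1.lt_of_ne fun h => ?_
    subst h
    exact (hbdry0 p hpΩ).not_gt hgpos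
  have htI : t ∈ Set.Ioc (0:ℝ) T0 := ⟨htpos, ht.2⟩
  have hslice : ∀ q ∈ Ω, g t q.1 q.2 ≤ g t p.1 p.2 := fun q hq =>
    le_of_mul_le_mul_left (hle t ht q (subset_closure hq)) (Real.exp_pos _)
  have hnhds : ∀ᶠ q : V d × V d in nhds p, q ∈ Ω := hΩo.mem_nhds hpΩ
  have hmaxx : IsLocalMax (fun y => g t y p.2) p.1 := by
    have hc : Filter.Tendsto (fun y : V d => (y, p.2)) (nhds p.1) (nhds p) :=
      (by fun_prop : Continuous fun y : V d => (y, p.2)).tendsto p.1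
    exact (hc.eventually hnhds).mono fun y hy => hslice _ hy
  have hmaxv : IsLocalMax (fun u => g t p.1 u) p.2 := by
    have hc : Filter.Tendsto (fun u : V d => (p.1, u)) (nhds p.2) (nhds p) :=
      (by fun_prop : Continuous fun u : V d => (p.1, u)).tendsto p.2
    exact (hc.eventually hnhds).mono fun u hu => hslice _ hu
  have htime : (Lam + 1) * g t p.1 p.2 ≤ deriv (fun s => g s p.1 p.2) t := by
    have hexp : HasDerivAt (fun s : ℝ => Real.exp (-(Lam + 1) * s))
        (Real.exp (-(Lam + 1) * t) * -(Lam + 1)) t := by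
      simpa using ((hasDerivAt_id t).const_mul (-(Lam + 1))).exp
    have h := (hexp.mul (hg_t t htI p hpΩ).hasDerivAt).nonneg_of_forall_le_right htpos
      fun s hs => hle s ⟨hs.1, hs.2.trans ht.2⟩ p hp
    have h' : 0 ≤ Real.exp (-(Lam + 1) * t) *
        (deriv (fun s => g s p.1 p.2) t - (Lam + 1) * g t p.1 p.2) := by
      linarith
    linarith [nonneg_of_mul_nonneg_right h' (Real.exp_pos _)]
  have htrace : ∑ i : Fin d, ∑ j : Fin d,
      a t p.1 p.2 i j * pd2 (fun u => g t p.1 u) p.2 i j ≤ 0 := by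
    have hA : (a t p.1 p.2).PosSemidef := posSemidef_of_qf_nonneg (ha_sym _ _ _) fun w =>
      (by positivity : 0 ≤ lam * ‖w‖ ^ 2).trans (ha_ell t ht p hpΩ w).1
    simp only [pd2_eq_fderiv_fderiv (hg_v t htI p hpΩ)]
    exact hA.sum_mul_bilin_nonpos _ (hmaxv.fderiv_fderiv_apply_nonpos (hg_v t htI p hpΩ))
  have hmain := hsub t htI p hpΩ
  rw [hmaxx.fderiv_eq_zero, hmaxv.fderiv_eq_zero] at hmain
  simp only [zero_apply, add_zero] at hmain
  have hc : c t p.1 p.2 * g t p.1 p.2 ≤ Lam * g t p.1 p.2 :=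
    mul_le_mul_of_nonneg_right ((le_abs_self _).trans (hc_bdd t ht p hpΩ)) hgpos.le
  linarith
end
end
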